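/- If φ(s) = ∑_{n=1}^∞ bₙ n^{-s} is a Dirichlet series bounded by M on every half-plane Re(s) > c with c > 0, then for every finite Dirichlet polynomial f, ∑-coefficient-wise we have ‖φf‖_{H_w} ≤ M ‖f‖_{H_w}, where ‖∑ aₙ n^{-s}‖²_{H_w} = ∑ |aₙ|² wₙ and wₙ = ∫_0^∞ n^{-2σ} dμ(σ) for a positive measure μ on [0,∞) with finite moments. -/

import Mathlib

open Filter Topology MeasureTheory

lemma cpow_diff_bound (w : ℂ) (hw : 0 < w.re) (k : ℕ) :
    ‖((k+1 : ℕ) : ℂ) ^ (-w) - ((k+2 : ℕ) : ℂ) ^ (-w)‖ ≤ ‖w‖ * ((k+1 : ℕ) : ℝ) ^ (-w.re - 1) := by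
  have hw0 : -w ≠ 0 := by
    intro h
    have : w = 0 := by simpa using h
    simp [this] at hw
  have hk : (0:ℝ) < k + 1 := by positivity
  have := Convex.norm_image_sub_le_of_norm_hasDerivWithin_le (𝕜 := ℝ)
    (f := fun t : ℝ => (t : ℂ) ^ (-w)) (f' := fun t : ℝ => -w * (t : ℂ) ^ (-w - 1))
    (s := Set.Icc ((k:ℝ)+1) (k+2)) (x := (k:ℝ)+2) (y := (k:ℝ)+1)
    (C := ‖w‖ * ((k+1 : ℕ) : ℝ) ^ (-w.re - 1)) ?_ ?_ (convex_Icc _ _) ?_ ?_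
  · have h1 : |(1:ℝ) - 2| = 1 := by norm_num
    simpa [h1] using this
  · intro x hx
    have hx0 : (0:ℝ) < x := hk.trans_le hx.1
    exact (hasDerivAt_ofReal_cpow_const hx0.ne' hw0).hasDerivWithinAt
  · intro x hx
    have hx0 : (0:ℝ) < x := hk.trans_le hx.1
    rw [norm_mul, norm_neg, Complex.norm_cpow_eq_rpow_re_of_pos hx0]
    gcongr
    simp only [Complex.sub_re, Complex.neg_re, Complex.one_re]
    push_cast
    exact Real.rpow_le_rpow_of_nonpos hk hx.1 (by linarith)
  · constructor <;> linarith
  · constructor <;> linarith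

lemma summation_by_parts (b : ℕ → ℂ) (e w : ℂ) (K : ℕ) :
    ∑ n ∈ Finset.Icc 1 K, b n * (n : ℂ) ^ (-(w + e)) =
      ∑ k ∈ Finset.range K, (∑ n ∈ Finset.Icc 1 (k+1), b n * (n : ℂ) ^ (-e)) *
        (((k+1 : ℕ) : ℂ) ^ (-w) - ((k+2 : ℕ) : ℂ) ^ (-w))
      + (∑ n ∈ Finset.Icc 1 K, b n * (n : ℂ) ^ (-e)) * ((K+1 : ℕ) : ℂ) ^ (-w) := by
  induction K with
  | zero => simp
  | succ K ih =>
    rw [Finset.sum_range_succ, Finset.sum_Icc_succ_top (by omega), ih,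
      Finset.sum_Icc_succ_top (by omega)]
    have : ((K+1 : ℕ) : ℂ) ^ (-(w + e)) = ((K+1 : ℕ) : ℂ) ^ (-w) * ((K+1 : ℕ) : ℂ) ^ (-e) := by
      rw [← Complex.cpow_add _ _ (by exact_mod_cast (Nat.succ_ne_zero K))]
      congr 1; ring
    rw [this]
    ring

lemma dirichlet_differentiableOn (b : ℕ → ℂ) (φ : ℂ → ℂ)
    (hconv : ∀ s : ℂ, 0 < s.re →
      Tendsto (fun K : ℕ => ∑ n ∈ Finset.Icc 1 K, b n * (n : ℂ) ^ (-s)) atTop (𝓝 (φ s))) :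
    DifferentiableOn ℂ φ {s : ℂ | 0 < s.re} := by
  intro s₀ hs₀
  have hs₀ : 0 < s₀.re := hs₀
  obtain ⟨ε, hε, hε3⟩ : ∃ ε : ℝ, 0 < ε ∧ 2 * ε < s₀.re := ⟨s₀.re / 3, by linarith, by linarith⟩
  obtain ⟨C, hC⟩ : ∃ C : ℝ, ∀ K : ℕ, ‖∑ n ∈ Finset.Icc 1 K, b n * (n : ℂ) ^ (-(ε:ℂ))‖ ≤ C := by
    have := Metric.isBounded_range_of_tendsto _ (hconv (ε : ℂ) (by simpa using hε))
    obtain ⟨C, hC⟩ := isBounded_iff_forall_norm_le.1 this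
    exact ⟨C, fun K => hC _ ⟨K, rfl⟩⟩
  have hC0 : 0 ≤ C := (norm_nonneg _).trans (hC 0)
  set R : ℝ := ‖s₀ - ε‖ + 1 with hR
  let U : Set ℂ := {s : ℂ | 2 * ε < s.re} ∩ {s : ℂ | ‖s - ε‖ < R}
  have hU : IsOpen U := (isOpen_lt continuous_const Complex.continuous_re).inter
    (isOpen_lt (by fun_prop) continuous_const)
  have hsU : s₀ ∈ U := ⟨hε3, by simp [hR]⟩
  let F : ℕ → ℂ → ℂ := fun k s => (∑ n ∈ Finset.Icc 1 (k+1), b n * (n : ℂ) ^ (-(ε:ℂ))) *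
        (((k+1 : ℕ) : ℂ) ^ (-(s - ε)) - ((k+2 : ℕ) : ℂ) ^ (-(s - ε)))
  let u : ℕ → ℝ := fun k => C * (R * ((k+1 : ℕ) : ℝ) ^ (-ε - 1))
  have hu : Summable u := by
    refine Summable.mul_left _ (Summable.mul_left _ ?_)
    exact (summable_nat_add_iff 1).2 (Real.summable_nat_rpow.2 (by linarith : -ε - 1 < -1))
  have hFu : ∀ k s, s ∈ U → ‖F k s‖ ≤ u k := by
    intro k s hs
    have h1 : 2 * ε < s.re := hs.1
    have h2 : ‖s - ε‖ < R := hs.2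
    have h3 : (s - ε).re = s.re - ε := by simp
    simp only [F, u]
    rw [norm_mul]
    refine mul_le_mul (hC _) ?_ (norm_nonneg _) hC0
    refine (cpow_diff_bound _ (by rw [h3]; linarith) k).trans ?_
    refine mul_le_mul h2.le ?_ (by positivity) ((norm_nonneg _).trans h2.le)
    refine Real.rpow_le_rpow_of_exponent_le (by simp) ?_
    rw [h3]; linarith
  have hd : DifferentiableOn ℂ (fun s => ∑' k, F k s) U := by
    refine Complex.differentiableOn_tsum_of_summable_norm hu ?_ hU hFu
    intro k s hs
    refine DifferentiableAt.differentiableWithinAt ?_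
    refine DifferentiableAt.const_mul ?_ _
    refine DifferentiableAt.sub ?_ ?_
    · exact DifferentiableAt.const_cpow (by fun_prop) (Or.inl (Nat.cast_ne_zero.2 (by omega)))
    · exact DifferentiableAt.const_cpow (by fun_prop) (Or.inl (Nat.cast_ne_zero.2 (by omega)))
  have heq : Set.EqOn φ (fun s => ∑' k, F k s) U := by
    intro s hs
    have h1 : 2 * ε < s.re := hs.1
    have hsum : Summable (fun k => F k s) := Summable.of_norm_bounded hu (fun k => hFu k s hs)
    have t1 := hsum.hasSum.tendsto_sum_nat
    have t2 : Tendsto (fun K : ℕ => (∑ n ∈ Finset.Icc 1 K, b n * (n : ℂ) ^ (-(ε:ℂ))) *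
        ((K+1 : ℕ) : ℂ) ^ (-(s - ε))) atTop (𝓝 0) := by
      rw [tendsto_zero_iff_norm_tendsto_zero]
      have t3 : Tendsto (fun K : ℕ => C * ((K+1 : ℕ) : ℝ) ^ (-(s.re - ε))) atTop (𝓝 (C * 0)) := by
        refine Tendsto.const_mul _ ?_
        exact (tendsto_rpow_neg_atTop (by linarith)).comp
          (tendsto_natCast_atTop_atTop.comp (tendsto_add_atTop_nat 1))
      rw [mul_zero] at t3
      refine squeeze_zero (fun _ => norm_nonneg _) (fun K => ?_) t3
      rw [norm_mul, Complex.norm_natCast_cpow_of_pos (Nat.succ_pos K)]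
      have : (-(s - (ε:ℂ))).re = -(s.re - ε) := by simp
      rw [this]
      exact mul_le_mul_of_nonneg_right (hC _) (by positivity)
    have t4 := t1.add t2
    rw [add_zero] at t4
    refine tendsto_nhds_unique (hconv s (by linarith)) (t4.congr fun K => ?_)
    rw [← summation_by_parts, sub_add_cancel]
  exact ((hd.congr heq).differentiableAt (hU.mem_nhds hsU)).differentiableWithinAt

/-- symmetric mean -/
noncomputable def mn (g : ℝ → ℂ) (T : ℝ) : ℂ := ((2 * T : ℝ) : ℂ)⁻¹ * ∫ t in (-T)..T, g t

lemma tendsto_of_bdd (g : ℝ → ℂ) (C : ℝ) (h : ∀ T > 0, ‖g T‖ ≤ C) :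
    Tendsto (fun T : ℝ => ((2 * T : ℝ) : ℂ)⁻¹ * g T) atTop (𝓝 0) := by
  rw [tendsto_zero_iff_norm_tendsto_zero]
  have t3 : Tendsto (fun T : ℝ => (2 * T)⁻¹ * C) atTop (𝓝 (0 * C)) :=
    Tendsto.mul_const _ (tendsto_inv_atTop_zero.comp (tendsto_id.const_mul_atTop (by norm_num)))
  rw [zero_mul] at t3
  refine squeeze_zero' (Eventually.of_forall fun _ => norm_nonneg _) ?_ t3
  filter_upwards [eventually_gt_atTop 0] with T hT
  rw [norm_mul, norm_inv, Complex.norm_real, Real.norm_of_nonneg (by positivity)]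
  exact mul_le_mul_of_nonneg_left (h T hT) (by positivity)

lemma mn_exp (l : ℝ) : Tendsto (mn (fun t => Complex.exp (Complex.I * l * t))) atTop
    (𝓝 (if l = 0 then 1 else 0)) := by
  split_ifs with h
  · refine tendsto_const_nhds.congr' ?_
    filter_upwards [eventually_gt_atTop 0] with T hT
    have hT' : (T:ℂ) ≠ 0 := by exact_mod_cast hT.ne'
    simp [mn, h]
    field_simp
    norm_num
  · refine tendsto_of_bdd _ (2 / |l|) ?_
    intro T hT
    have hl : Complex.I * l ≠ 0 := by simp [h]
    rw [integral_exp_mul_complex hl, norm_div]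
    have hn : ‖Complex.I * l‖ = |l| := by simp
    rw [hn]
    gcongr
    refine (norm_sub_le _ _).trans ?_
    rw [Complex.norm_exp, Complex.norm_exp]
    simp
    norm_num

lemma mn_norm_le (g : ℝ → ℂ) (C T : ℝ) (hT : 0 < T) (h : ∀ t, ‖g t‖ ≤ C) : ‖mn g T‖ ≤ C := by
  have := intervalIntegral.norm_integral_le_of_norm_le_const (a := -T) (b := T) (f := g)
    (fun x _ => h x)
  rw [mn, norm_mul, norm_inv, Complex.norm_real, Real.norm_of_nonneg (by positivity),
    inv_mul_le_iff₀ (by positivity)]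
  rw [show T - -T = 2 * T by ring, abs_of_pos (by positivity)] at this
  linarith

lemma mn_sum {ι : Type*} (S : Finset ι) (g : ι → ℝ → ℂ) (hg : ∀ i ∈ S, Continuous (g i)) (T : ℝ) :
    mn (fun t => ∑ i ∈ S, g i t) T = ∑ i ∈ S, mn (g i) T := by
  simp only [mn]
  rw [intervalIntegral.integral_finsetSum, Finset.mul_sum]
  intro i hi
  exact (hg i hi).intervalIntegrable _ _

lemma mn_const_mul (c : ℂ) (g : ℝ → ℂ) (T : ℝ) : mn (fun t => c * g t) T = c * mn g T := by
  simp only [mn]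
  rw [intervalIntegral.integral_const_mul]; ring


lemma mn_tsum (β : ℕ → ℂ) (l : ℕ → ℝ) (g : ℝ → ℂ) (hβ : Summable fun m => ‖β m‖)
    (hg : ∀ t : ℝ, HasSum (fun m => β m * Complex.exp (Complex.I * l m * t)) (g t)) :
    Tendsto (mn g) atTop (𝓝 (∑' m, β m * (if l m = 0 then 1 else 0))) := by
  have hn : ∀ (m : ℕ) (t : ℝ), ‖Complex.exp (Complex.I * l m * t)‖ = 1 := by
    intro m t
    rw [Complex.norm_exp]; simp
  have hint : ∀ T, mn g T = ∑' m, β m * mn (fun t => Complex.exp (Complex.I * l m * t)) T := by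
    intro T
    have := intervalIntegral.hasSum_integral_of_dominated_convergence (μ := volume)
      (a := -T) (b := T) (f := g)
      (F := fun m t => β m * Complex.exp (Complex.I * l m * t)) (fun m _ => ‖β m‖)
      (fun m => by
        refine Continuous.aestronglyMeasurable ?_
        fun_prop)
      (fun m => Eventually.of_forall fun t _ => by rw [norm_mul, hn, mul_one])
      (Eventually.of_forall fun t _ => hβ)
      (by simp)
      (Eventually.of_forall fun t _ => hg t)
    have h2 := (this.mul_left (((2 * T : ℝ) : ℂ)⁻¹)).tsum_eq
    rw [mn, ← h2]
    refine tsum_congr fun m => ?_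
    rw [intervalIntegral.integral_const_mul, mn]; ring
  rw [show mn g = _ from funext hint]
  refine tendsto_tsum_of_dominated_convergence hβ (fun m => (mn_exp (l m)).const_mul _) ?_
  filter_upwards [eventually_gt_atTop 0] with T hT m
  rw [norm_mul]
  exact mul_le_of_le_one_right (norm_nonneg _) (mn_norm_le _ 1 T hT fun t => (hn m t).le)

lemma sum_Icc_range (g : ℕ → ℂ) (K : ℕ) :
    ∑ n ∈ Finset.Icc 1 K, g n = ∑ m ∈ Finset.range K, g (m+1) := by
  induction K with
  | zero => simp
  | succ K ih => rw [Finset.sum_range_succ, Finset.sum_Icc_succ_top (by omega), ih]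

lemma natCast_cpow_exp (m : ℕ) (s : ℂ) :
    ((m + 1 : ℕ) : ℂ) ^ s = Complex.exp (s * (Real.log ((m+1 : ℕ) : ℝ) : ℝ)) := by
  rw [Complex.cpow_def_of_ne_zero (Nat.cast_ne_zero.2 (by omega)), Complex.ofReal_log (by positivity),
    mul_comm]
  simp

lemma mn_line3 (b : ℕ → ℂ) (φ : ℂ → ℂ)
    (hconv : ∀ s : ℂ, 0 < s.re →
      Tendsto (fun K : ℕ => ∑ n ∈ Finset.Icc 1 K, b n * (n : ℂ) ^ (-s)) atTop (𝓝 (φ s)))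
    (k n : ℕ) (hk : 1 ≤ k) (hn : 1 ≤ n) :
    Tendsto (mn (fun t => φ ((3:ℝ) + t * Complex.I) *
      Complex.exp (((3:ℝ) + t * Complex.I) * (Real.log k - Real.log n : ℝ)))) atTop
      (𝓝 (if n ∣ k then b (k / n) else 0)) := by
  set L : ℝ := Real.log k - Real.log n with hL
  obtain ⟨C, hC⟩ : ∃ C : ℝ, ∀ K : ℕ, ‖∑ n ∈ Finset.Icc 1 K, b n * (n : ℂ) ^ (-(1:ℂ))‖ ≤ C := by
    have := Metric.isBounded_range_of_tendsto _ (hconv 1 (by simp))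
    obtain ⟨C, hC⟩ := isBounded_iff_forall_norm_le.1 this
    exact ⟨C, fun K => hC _ ⟨K, rfl⟩⟩
  have hb : ∀ m : ℕ, ‖b (m+1)‖ ≤ 2 * C * ((m+1 : ℕ) : ℝ) := by
    intro m
    have h1 := hC (m+1)
    rw [Finset.sum_Icc_succ_top (by omega)] at h1
    have h2 := hC m
    have h3 : ‖b (m+1) * ((m+1 : ℕ) : ℂ) ^ (-(1:ℂ))‖ ≤ 2 * C := by
      have := norm_sub_le (∑ n ∈ Finset.Icc 1 m, b n * (n : ℂ) ^ (-(1:ℂ)) +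
        b (m+1) * ((m+1 : ℕ) : ℂ) ^ (-(1:ℂ))) (∑ n ∈ Finset.Icc 1 m, b n * (n : ℂ) ^ (-(1:ℂ)))
      rw [add_sub_cancel_left] at this
      linarith
    rw [norm_mul, Complex.cpow_neg_one, norm_inv, Complex.norm_natCast, ← div_eq_mul_inv,
      div_le_iff₀ (by positivity)] at h3
    exact h3
  let β : ℕ → ℂ := fun m => b (m+1) * Complex.exp ((3:ℝ) * ((L - Real.log ((m+1 : ℕ) : ℝ) : ℝ) : ℂ))
  let l : ℕ → ℝ := fun m => L - Real.log ((m+1 : ℕ) : ℝ)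
  have hβ : Summable fun m => ‖β m‖ := by
    have hs : Summable fun m : ℕ => 2 * C * Real.exp (3 * L) * ((m+1 : ℕ) : ℝ) ^ (-2 : ℝ) :=
      Summable.mul_left _ ((summable_nat_add_iff 1).2 (Real.summable_nat_rpow.2 (by norm_num)))
    refine Summable.of_nonneg_of_le (fun _ => norm_nonneg _) (fun m => ?_) hs
    have hm : (0:ℝ) < ((m+1 : ℕ) : ℝ) := by positivity
    have e1 : ‖Complex.exp ((3:ℝ) * ((L - Real.log ((m+1 : ℕ) : ℝ) : ℝ) : ℂ))‖ =
        Real.exp (3 * L) * ((m+1 : ℕ) : ℝ) ^ (-3 : ℝ) := by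
      rw [Complex.norm_exp, Real.rpow_def_of_pos hm, ← Real.exp_add, ← Complex.ofReal_mul,
        Complex.ofReal_re]
      congr 1; ring
    have e2 : ((m+1 : ℕ) : ℝ) ^ (-2 : ℝ) = ((m+1 : ℕ) : ℝ) * ((m+1 : ℕ) : ℝ) ^ (-3 : ℝ) := by
      nth_rewrite 2 [← Real.rpow_one ((m+1 : ℕ) : ℝ)]
      rw [← Real.rpow_add hm]; norm_num
    simp only [β]
    rw [norm_mul, e1, e2]
    calc _ ≤ (2 * C * ((m+1 : ℕ) : ℝ)) * (Real.exp (3 * L) * ((m+1 : ℕ) : ℝ) ^ (-3 : ℝ)) :=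
          mul_le_mul_of_nonneg_right (hb m) (by positivity)
      _ = _ := by ring
  have hterm : ∀ (t : ℝ) (m : ℕ), β m * Complex.exp (Complex.I * l m * t) =
      b (m+1) * ((m+1 : ℕ) : ℂ) ^ (-((3:ℝ) + t * Complex.I)) *
        Complex.exp (((3:ℝ) + t * Complex.I) * L) := by
    intro t m
    rw [natCast_cpow_exp]
    simp only [β, l]
    rw [mul_assoc (b _), mul_assoc (b _), ← Complex.exp_add, ← Complex.exp_add]
    congr 2
    push_cast
    ring
  have hg : ∀ t : ℝ, HasSum (fun m => β m * Complex.exp (Complex.I * l m * t))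
      (φ ((3:ℝ) + t * Complex.I) * Complex.exp (((3:ℝ) + t * Complex.I) * L)) := by
    intro t
    have hsum : Summable (fun m => β m * Complex.exp (Complex.I * l m * t)) := by
      refine Summable.of_norm_bounded hβ (fun m => ?_)
      rw [norm_mul, Complex.norm_exp]; simp
    have t1 := hsum.hasSum.tendsto_sum_nat
    have t2 := (hconv ((3:ℝ) + t * Complex.I) (by simp)).mul_const
      (Complex.exp (((3:ℝ) + t * Complex.I) * L))
    have t3 := tendsto_nhds_unique t2 (t1.congr fun K => by
      rw [sum_Icc_range, Finset.sum_mul]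
      exact Finset.sum_congr rfl fun m _ => hterm t m)
    rw [t3]
    exact hsum.hasSum
  have hlim := mn_tsum β l _ hβ hg
  convert hlim using 2
  have hl : ∀ m, l m = 0 ↔ k = n * (m+1) := by
    intro m
    have hk0 : (0:ℝ) < k := by exact_mod_cast hk
    have hn0 : (0:ℝ) < n := by exact_mod_cast hn
    have hm0 : (0:ℝ) < ((m+1 : ℕ) : ℝ) := by positivity
    simp only [l, hL]
    rw [sub_sub, ← Real.log_mul hn0.ne' hm0.ne', sub_eq_zero]
    constructor
    · intro h
      have := Real.log_injOn_pos (Set.mem_Ioi.2 hk0) (Set.mem_Ioi.2 (by positivity)) h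
      exact_mod_cast this
    · intro h
      rw [h]; push_cast; rfl
  split_ifs with hd
  · obtain ⟨q, rfl⟩ := hd
    obtain ⟨m, rfl⟩ : ∃ m, q = m + 1 := Nat.exists_eq_succ_of_ne_zero (by
      rintro rfl; omega)
    rw [tsum_eq_single m]
    · have h0 : l m = 0 := (hl m).2 rfl
      have h0' : L - Real.log ((m+1 : ℕ) : ℝ) = 0 := h0
      rw [if_pos h0, Nat.mul_div_cancel_left _ (by omega)]
      simp only [β]
      rw [h0']; simp
    · intro m' hm'
      rw [if_neg, mul_zero]
      rw [hl]
      intro h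
      have := Nat.eq_of_mul_eq_mul_left (by omega) h
      omega
  · symm
    refine (tsum_congr fun m => ?_).trans tsum_zero
    rw [if_neg, mul_zero]
    rw [hl]
    rintro h
    exact hd ⟨_, h⟩

lemma contour_shift (φ : ℂ → ℂ) (M : ℝ) (hM : 0 ≤ M)
    (hd : DifferentiableOn ℂ φ {s : ℂ | 0 < s.re})
    (hbdd : ∀ s : ℂ, 0 < s.re → ‖φ s‖ ≤ M) (σ τ : ℝ) (hσ : 0 < σ) (hτ : 0 < τ) (L : ℝ) (A : ℂ)
    (h : Tendsto (mn (fun t => φ (τ + t * Complex.I) *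
      Complex.exp ((τ + t * Complex.I) * L))) atTop (𝓝 A)) :
    Tendsto (mn (fun t => φ (σ + t * Complex.I) *
      Complex.exp ((σ + t * Complex.I) * L))) atTop (𝓝 A) := by
  set H : ℂ → ℂ := fun s => φ s * Complex.exp (s * L) with hH
  have hHd : DifferentiableOn ℂ H {s : ℂ | 0 < s.re} := hd.mul (by fun_prop)
  set C : ℝ := M * Real.exp ((σ + τ) * |L|)
  have hpos : ∀ x ∈ Set.uIcc σ τ, 0 < x := fun x hx => lt_of_lt_of_le (lt_min hσ hτ) hx.1
  have hHb : ∀ x ∈ Set.uIcc σ τ, ∀ y : ℝ, ‖H (x + y * Complex.I)‖ ≤ C := by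
    intro x hx y
    have h0 := hpos x hx
    simp only [hH]
    rw [norm_mul]
    refine mul_le_mul (hbdd _ (by simpa using h0)) ?_ (norm_nonneg _) hM
    rw [Complex.norm_exp]
    refine Real.exp_le_exp.2 ?_
    simp
    have h1 : x ≤ σ + τ := hx.2.trans (max_le (by linarith) (by linarith))
    calc x * L ≤ x * |L| := mul_le_mul_of_nonneg_left (le_abs_self _) h0.le
      _ ≤ _ := mul_le_mul_of_nonneg_right h1 (abs_nonneg _)
  have hdiff : Tendsto (fun T : ℝ => ((2 * T : ℝ) : ℂ)⁻¹ *
      ((∫ t in (-T)..T, H (σ + t * Complex.I)) - ∫ t in (-T)..T, H (τ + t * Complex.I)))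
      atTop (𝓝 0) := by
    refine tendsto_of_bdd _ (C * |τ - σ| + C * |τ - σ|) ?_
    intro T hT
    have hr := Complex.integral_boundary_rect_eq_zero_of_differentiableOn H
      (⟨σ, -T⟩ : ℂ) (⟨τ, T⟩ : ℂ) (hHd.mono fun s hs => hpos _ hs.1)
    simp only [smul_eq_mul] at hr
    have b1 := intervalIntegral.norm_integral_le_of_norm_le_const (a := σ) (b := τ)
      (f := fun x : ℝ => H (x + (-T : ℝ) * Complex.I))
      (fun x hx => hHb x (Set.uIoc_subset_uIcc hx) _)
    have b2 := intervalIntegral.norm_integral_le_of_norm_le_const (a := σ) (b := τ)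
      (f := fun x : ℝ => H (x + (T : ℝ) * Complex.I))
      (fun x hx => hHb x (Set.uIoc_subset_uIcc hx) _)
    set X := ∫ (x : ℝ) in σ..τ, H (x + (-T : ℝ) * Complex.I)
    set Y := ∫ (x : ℝ) in σ..τ, H (x + (T : ℝ) * Complex.I)
    set P := ∫ t in (-T)..T, H (σ + t * Complex.I)
    set Q := ∫ t in (-T)..T, H (τ + t * Complex.I)
    have h3 : Complex.I * (P - Q) = X - Y := by linear_combination -hr
    have h4 : ‖P - Q‖ = ‖X - Y‖ := by rw [← h3, norm_mul, Complex.norm_I, one_mul]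
    rw [h4]
    exact (norm_sub_le _ _).trans (add_le_add b1 b2)
  have := h.add hdiff
  rw [add_zero] at this
  refine this.congr fun T => ?_
  simp only [mn]
  ring

lemma mn_re_nonneg (h : ℝ → ℂ) (hc : Continuous h) (h0 : ∀ t, 0 ≤ (h t).re) (T : ℝ) (hT : 0 < T) :
    0 ≤ (mn h T).re := by
  have h1 := Complex.reCLM.intervalIntegral_comp_comm (hc.intervalIntegrable (μ := volume) (-T) T)
  have h2 : 0 ≤ ∫ t in (-T)..T, (h t).re :=
    intervalIntegral.integral_nonneg (by linarith) fun t _ => h0 t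
  have h3 : (∫ t in (-T)..T, h t).re = ∫ t in (-T)..T, (h t).re := h1.symm
  rw [mn, ← Complex.ofReal_inv, Complex.re_ofReal_mul, h3]
  positivity

/-- `n^{-(σ+it)}` -/
noncomputable def ee (σ : ℝ) (n : ℕ) (t : ℝ) : ℂ :=
  Complex.exp (-(σ + t * Complex.I) * (Real.log n : ℝ))

lemma ee_cont (σ : ℝ) (n : ℕ) : Continuous (ee σ n) := by
  unfold ee; fun_prop

lemma conj_ee (σ : ℝ) (n : ℕ) (t : ℝ) :
    (starRingEnd ℂ) (ee σ n t) = (Real.exp (-2 * σ * Real.log n) : ℝ) *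
      Complex.exp ((σ + t * Complex.I) * (Real.log n : ℝ)) := by
  rw [ee, ← Complex.exp_conj, Complex.ofReal_exp, ← Complex.exp_add]
  congr 1
  simp only [map_mul, map_neg, map_add, Complex.conj_ofReal, Complex.conj_I]
  push_cast
  ring

lemma mn_ortho (σ : ℝ) (n m : ℕ) (hn : 1 ≤ n) (hm : 1 ≤ m) :
    Tendsto (mn (fun t => ee σ n t * (starRingEnd ℂ) (ee σ m t))) atTop
      (𝓝 (if n = m then ((Real.exp (-2 * σ * Real.log n) : ℝ) : ℂ) else 0)) := by
  have h := (mn_exp (Real.log m - Real.log n)).const_mul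
    ((Real.exp (-σ * (Real.log n + Real.log m)) : ℝ) : ℂ)
  have hn0 : (0:ℝ) < n := by exact_mod_cast hn
  have hm0 : (0:ℝ) < m := by exact_mod_cast hm
  have hl : Real.log m - Real.log n = 0 ↔ n = m := by
    rw [sub_eq_zero]
    constructor
    · intro h
      have := Real.log_injOn_pos (Set.mem_Ioi.2 hm0) (Set.mem_Ioi.2 hn0) h
      exact_mod_cast this.symm
    · rintro rfl; rfl
  have e : ((Real.exp (-σ * (Real.log n + Real.log m)) : ℝ) : ℂ) *
      (if Real.log m - Real.log n = 0 then 1 else 0) =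
      (if n = m then ((Real.exp (-2 * σ * Real.log n) : ℝ) : ℂ) else 0) := by
    simp only [hl]
    split_ifs with hnm
    · subst hnm
      rw [mul_one]; congr 2; ring
    · simp
  rw [e] at h
  refine h.congr fun T => ?_
  rw [← mn_const_mul]
  congr 1
  funext t
  rw [conj_ee, ee, Complex.ofReal_exp, Complex.ofReal_exp, ← Complex.exp_add, ← Complex.exp_add,
    ← Complex.exp_add]
  congr 1
  push_cast
  ring

lemma mn_poly (σ : ℝ) (S : Finset ℕ) (hS : ∀ n ∈ S, 1 ≤ n) (p : ℕ → ℂ) :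
    Tendsto (mn (fun t => (∑ n ∈ S, p n * ee σ n t) *
      (starRingEnd ℂ) (∑ n ∈ S, p n * ee σ n t))) atTop
      (𝓝 ((∑ n ∈ S, ‖p n‖ ^ 2 * Real.exp (-2 * σ * Real.log n) : ℝ) : ℂ)) := by
  have h : Tendsto (fun T => ∑ n ∈ S, ∑ m ∈ S, p n * (starRingEnd ℂ) (p m) *
      mn (fun t => ee σ n t * (starRingEnd ℂ) (ee σ m t)) T) atTop
      (𝓝 (∑ n ∈ S, ∑ m ∈ S, p n * (starRingEnd ℂ) (p m) *
        (if n = m then ((Real.exp (-2 * σ * Real.log n) : ℝ) : ℂ) else 0))) :=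
    tendsto_finsetSum _ fun n hn => tendsto_finsetSum _ fun m hm =>
      (mn_ortho σ n m (hS n hn) (hS m hm)).const_mul _
  have e : (∑ n ∈ S, ∑ m ∈ S, p n * (starRingEnd ℂ) (p m) *
        (if n = m then ((Real.exp (-2 * σ * Real.log n) : ℝ) : ℂ) else 0)) =
      ((∑ n ∈ S, ‖p n‖ ^ 2 * Real.exp (-2 * σ * Real.log n) : ℝ) : ℂ) := by
    rw [Complex.ofReal_sum]
    refine Finset.sum_congr rfl fun n hn => ?_
    simp only [mul_ite, mul_zero]
    rw [Finset.sum_ite_eq, if_pos hn, Complex.mul_conj, Complex.normSq_eq_norm_sq]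
    push_cast; rfl
  rw [e] at h
  refine h.congr fun T => ?_
  have : (fun t => (∑ n ∈ S, p n * ee σ n t) * (starRingEnd ℂ) (∑ n ∈ S, p n * ee σ n t)) =
      fun t => ∑ n ∈ S, ∑ m ∈ S, p n * (starRingEnd ℂ) (p m) *
        (ee σ n t * (starRingEnd ℂ) (ee σ m t)) := by
    funext t
    rw [map_sum, Finset.sum_mul_sum]
    refine Finset.sum_congr rfl fun n _ => Finset.sum_congr rfl fun m _ => ?_
    rw [map_mul]; ring
  have hc : ∀ n m, Continuous fun t => p n * (starRingEnd ℂ) (p m) *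
        (ee σ n t * (starRingEnd ℂ) (ee σ m t)) := fun n m =>
    continuous_const.mul ((ee_cont σ n).mul (Complex.continuous_conj.comp (ee_cont σ m)))
  rw [this, mn_sum _ _ fun n _ => continuous_finsetSum _ fun m _ => hc n m]
  refine Finset.sum_congr rfl fun n _ => ?_
  rw [mn_sum _ _ fun m _ => hc n m]
  refine Finset.sum_congr rfl fun m _ => ?_
  rw [mn_const_mul]

lemma conv_eq (b a : ℕ → ℂ) (S : Finset ℕ) (ha : ∀ n, n ∉ S → a n = 0) (k : ℕ) (hk : 1 ≤ k) :
    ∑ n ∈ S, a n * (if n ∣ k then b (k / n) else 0) = ∑ d ∈ k.divisors, b d * a (k / d) := by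
  have h1 : ∑ d ∈ k.divisors, b d * a (k / d) = ∑ d ∈ k.divisors, b (k / d) * a d := by
    rw [← Nat.sum_div_divisors]
    refine Finset.sum_congr rfl fun d hd => ?_
    rw [Nat.div_div_self (Nat.dvd_of_mem_divisors hd) (by omega)]
  rw [h1]
  simp only [mul_ite, mul_zero]
  rw [← Finset.sum_filter]
  have h2 : S.filter (· ∣ k) ⊆ k.divisors := by
    intro n hn
    rw [Finset.mem_filter] at hn
    exact Nat.mem_divisors.2 ⟨hn.2, by omega⟩
  rw [← Finset.sum_subset (f := fun d => b (k / d) * a d) h2]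
  · exact Finset.sum_congr rfl fun n _ => mul_comm _ _
  · intro n hn hn'
    rw [ha n, mul_zero]
    intro hS
    exact hn' (Finset.mem_filter.2 ⟨hS, Nat.dvd_of_mem_divisors hn⟩)

lemma mn_lin (r : ℂ) (x y z : ℝ → ℂ) (c1 : Continuous x) (c2 : Continuous y) (c3 : Continuous z)
    (T : ℝ) : mn (fun t => r * x t + y t - 2 * z t) T = r * mn x T + mn y T - 2 * mn z T := by
  have d1 : Continuous fun t => r * x t := by fun_prop
  have d2 : Continuous fun t => r * x t + y t := by fun_prop
  have d3 : Continuous fun t => 2 * z t := by fun_prop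
  simp only [mn]
  rw [intervalIntegral.integral_sub (d2.intervalIntegrable _ _) (d3.intervalIntegrable _ _),
    intervalIntegral.integral_add (d1.intervalIntegrable _ _) (c2.intervalIntegrable _ _),
    intervalIntegral.integral_const_mul, intervalIntegral.integral_const_mul]
  ring

lemma key_pos
    (b : ℕ → ℂ) (φ : ℂ → ℂ) (M : ℝ) (hM : 0 ≤ M)
    (hconv : ∀ s : ℂ, 0 < s.re →
      Tendsto (fun K : ℕ => ∑ n ∈ Finset.Icc 1 K, b n * (n : ℂ) ^ (-s)) atTop (𝓝 (φ s)))
    (hbdd : ∀ s : ℂ, 0 < s.re → ‖φ s‖ ≤ M)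
    (S : Finset ℕ) (hS : ∀ n ∈ S, 1 ≤ n) (a : ℕ → ℂ) (ha : ∀ n, n ∉ S → a n = 0)
    (F : Finset ℕ) (hF : ∀ n ∈ F, 1 ≤ n) (σ : ℝ) (hσ : 0 < σ) :
    ∑ k ∈ F, ‖∑ d ∈ k.divisors, b d * a (k / d)‖ ^ 2 * Real.exp (-2 * σ * Real.log k) ≤
      M ^ 2 * ∑ n ∈ S, ‖a n‖ ^ 2 * Real.exp (-2 * σ * Real.log n) := by
  set c : ℕ → ℂ := fun k => ∑ d ∈ k.divisors, b d * a (k / d) with hc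
  have hd := dirichlet_differentiableOn b φ hconv
  have hφc : Continuous fun t : ℝ => φ (σ + t * Complex.I) := by
    refine hd.continuousOn.comp_continuous (by fun_prop) fun t => ?_
    simpa using hσ
  have hmain : ∀ k n, 1 ≤ k → 1 ≤ n →
      Tendsto (mn (fun t => φ (σ + t * Complex.I) * (ee σ n t * (starRingEnd ℂ) (ee σ k t)))) atTop
      (𝓝 ((Real.exp (-2 * σ * Real.log k) : ℝ) * (if n ∣ k then b (k / n) else 0))) := by
    intro k n hk hn
    have h := (contour_shift φ M hM hd hbdd σ 3 hσ (by norm_num) _ _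
      (mn_line3 b φ hconv k n hk hn)).const_mul ((Real.exp (-2 * σ * Real.log k) : ℝ) : ℂ)
    refine h.congr fun T => ?_
    rw [← mn_const_mul]
    congr 1
    funext t
    rw [conj_ee, ee, mul_left_comm (Complex.exp _), ← Complex.exp_add, mul_left_comm]
    congr 3
    push_cast
    ring_nf
  let g : ℝ → ℂ := fun t => ∑ n ∈ S, a n * ee σ n t
  let P : ℝ → ℂ := fun t => ∑ k ∈ F, c k * ee σ k t
  have hgc : Continuous g := continuous_finsetSum _ fun n _ => continuous_const.mul (ee_cont σ n)
  have hPc : Continuous P := continuous_finsetSum _ fun n _ => continuous_const.mul (ee_cont σ n)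
  have l1 : Tendsto (mn (fun t => g t * (starRingEnd ℂ) (g t))) atTop _ := mn_poly σ S hS a
  have l2 : Tendsto (mn (fun t => P t * (starRingEnd ℂ) (P t))) atTop _ := mn_poly σ F hF c
  have l3 : Tendsto (mn (fun t => φ (σ + t * Complex.I) * (g t * (starRingEnd ℂ) (P t)))) atTop
      (𝓝 ((∑ k ∈ F, ‖c k‖ ^ 2 * Real.exp (-2 * σ * Real.log k) : ℝ) : ℂ)) := by
    have h : Tendsto (fun T => ∑ k ∈ F, ∑ n ∈ S, (starRingEnd ℂ) (c k) * a n *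
        mn (fun t => φ (σ + t * Complex.I) * (ee σ n t * (starRingEnd ℂ) (ee σ k t))) T) atTop
        (𝓝 (∑ k ∈ F, ∑ n ∈ S, (starRingEnd ℂ) (c k) * a n *
          ((Real.exp (-2 * σ * Real.log k) : ℝ) * (if n ∣ k then b (k / n) else 0)))) :=
      tendsto_finsetSum _ fun k hk => tendsto_finsetSum _ fun n hn =>
        (hmain k n (hF k hk) (hS n hn)).const_mul _
    have e : (∑ k ∈ F, ∑ n ∈ S, (starRingEnd ℂ) (c k) * a n *
          (((Real.exp (-2 * σ * Real.log k) : ℝ) : ℂ) * (if n ∣ k then b (k / n) else 0))) =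
        ((∑ k ∈ F, ‖c k‖ ^ 2 * Real.exp (-2 * σ * Real.log k) : ℝ) : ℂ) := by
      rw [Complex.ofReal_sum]
      refine Finset.sum_congr rfl fun k hk => ?_
      have h1 : c k = ∑ n ∈ S, a n * (if n ∣ k then b (k / n) else 0) :=
        (conv_eq b a S ha k (hF k hk)).symm
      rw [Complex.ofReal_mul, Complex.ofReal_pow, ← Complex.conj_mul']
      nth_rewrite 3 [h1]
      rw [Finset.mul_sum, Finset.sum_mul]
      refine Finset.sum_congr rfl fun n _ => ?_
      ring
    rw [e] at h
    refine h.congr fun T => ?_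
    have : (fun t : ℝ => φ (σ + t * Complex.I) * (g t * (starRingEnd ℂ) (P t))) =
        fun t : ℝ => ∑ k ∈ F, ∑ n ∈ S, (starRingEnd ℂ) (c k) * a n *
          (φ (σ + t * Complex.I) * (ee σ n t * (starRingEnd ℂ) (ee σ k t))) := by
      funext t
      simp only [g, P]
      rw [map_sum, Finset.sum_mul_sum, Finset.sum_comm, Finset.mul_sum]
      refine Finset.sum_congr rfl fun n _ => ?_
      rw [Finset.mul_sum]
      refine Finset.sum_congr rfl fun m _ => ?_
      rw [map_mul]; ring
    have hcc : ∀ k n, Continuous fun t : ℝ => (starRingEnd ℂ) (c k) * a n *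
          (φ (σ + t * Complex.I) * (ee σ n t * (starRingEnd ℂ) (ee σ k t))) := fun k n =>
      continuous_const.mul (hφc.mul
        ((ee_cont σ n).mul (Complex.continuous_conj.comp (ee_cont σ k))))
    rw [this, mn_sum _ _ fun k _ => continuous_finsetSum _ fun n _ => hcc k n]
    refine Finset.sum_congr rfl fun k _ => ?_
    rw [mn_sum _ _ fun n _ => hcc k n]
    refine Finset.sum_congr rfl fun n _ => ?_
    rw [mn_const_mul]
  have l4 := ((l1.const_mul ((M : ℂ) ^ 2)).add l2).sub (l3.const_mul 2)
  have l5 := (Complex.continuous_re.tendsto _).comp l4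
  have hge := ge_of_tendsto (b := 0) l5 (by
    filter_upwards [eventually_gt_atTop 0] with T hT
    have c1 : Continuous fun t => g t * (starRingEnd ℂ) (g t) :=
      hgc.mul (Complex.continuous_conj.comp hgc)
    have c2 : Continuous fun t => P t * (starRingEnd ℂ) (P t) :=
      hPc.mul (Complex.continuous_conj.comp hPc)
    have c3 : Continuous fun t : ℝ => φ (σ + t * Complex.I) * (g t * (starRingEnd ℂ) (P t)) :=
      hφc.mul (hgc.mul (Complex.continuous_conj.comp hPc))
    have hnn := mn_re_nonneg (fun t : ℝ => (M:ℂ) ^ 2 * (g t * (starRingEnd ℂ) (g t)) +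
      P t * (starRingEnd ℂ) (P t) - 2 * (φ (σ + t * Complex.I) * (g t * (starRingEnd ℂ) (P t))))
      (((continuous_const.mul c1).add c2).sub (continuous_const.mul c3)) ?_ T hT
    · refine hnn.trans_eq (Eq.symm ?_)
      rw [mn_lin _ _ _ _ c1 c2 c3]
      rfl
    · intro t
      have hb1 : ‖φ (σ + t * Complex.I)‖ ≤ M := hbdd _ (by simpa using hσ)
      have hb2 : (φ (σ + t * Complex.I) * (g t * (starRingEnd ℂ) (P t))).re ≤
          M * (‖g t‖ * ‖P t‖) := by
        refine (Complex.re_le_norm _).trans ?_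
        rw [norm_mul, norm_mul, Complex.norm_conj]
        exact mul_le_mul_of_nonneg_right hb1 (by positivity)
      have e1 : ((M:ℂ) ^ 2 * (g t * (starRingEnd ℂ) (g t))).re = M ^ 2 * ‖g t‖ ^ 2 := by
        rw [Complex.mul_conj']; norm_cast
      have e2 : (P t * (starRingEnd ℂ) (P t)).re = ‖P t‖ ^ 2 := by
        rw [Complex.mul_conj']; norm_cast
      have e3 : ∀ z : ℂ, (2 * z).re = 2 * z.re := by intro z; simp
      rw [Complex.sub_re, Complex.add_re, e1, e2, e3]
      nlinarith [sq_nonneg (M * ‖g t‖ - ‖P t‖)])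
  have e4 : ∀ x y : ℝ, ((M:ℂ) ^ 2 * (x:ℂ) + (y:ℂ) - 2 * (y:ℂ)).re = M ^ 2 * x + y - 2 * y := by
    intro x y; norm_cast
  rw [e4] at hge
  linarith

theorem multiplier_norm_le (μ : Measure ℝ) (hneg : μ (Set.Iio 0) = 0)
    (hint : ∀ n : ℕ, 1 ≤ n → Integrable (fun σ : ℝ => (n : ℝ) ^ (-2 * σ)) μ)
    (b : ℕ → ℂ) (φ : ℂ → ℂ) (M : ℝ) (hM : 0 ≤ M)
    (hconv : ∀ s : ℂ, 0 < s.re →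
      Tendsto (fun K : ℕ => ∑ n ∈ Finset.Icc 1 K, b n * (n : ℂ) ^ (-s)) atTop (𝓝 (φ s)))
    (hbdd : ∀ s : ℂ, 0 < s.re → ‖φ s‖ ≤ M)
    (n₀ N : ℕ) (hn₀ : 1 ≤ n₀) (a : ℕ → ℂ)
    (ha : ∀ n : ℕ, n ∉ Finset.Icc n₀ N → a n = 0) :
    (∑' k : ℕ, ‖∑ d ∈ k.divisors, b d * a (k / d)‖ ^ 2 * ∫ σ, (k : ℝ) ^ (-2 * σ) ∂μ)
      ≤ M ^ 2 * ∑ n ∈ Finset.Icc n₀ N, ‖a n‖ ^ 2 * ∫ σ, (n : ℝ) ^ (-2 * σ) ∂μ := by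
  have hS : ∀ n ∈ Finset.Icc n₀ N, 1 ≤ n := fun n hn => hn₀.trans (Finset.mem_Icc.1 hn).1
  refine Real.tsum_le_of_sum_le ?_ ?_
  · intro k
    exact mul_nonneg (by positivity) (integral_nonneg fun σ => by positivity)
  intro F₀
  set F := F₀.filter (1 ≤ ·) with hFdef
  have hF : ∀ k ∈ F, 1 ≤ k := fun k hk => (Finset.mem_filter.1 hk).2
  have hFF : ∑ k ∈ F, ‖∑ d ∈ k.divisors, b d * a (k / d)‖ ^ 2 * ∫ σ, (k : ℝ) ^ (-2 * σ) ∂μ =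
      ∑ k ∈ F₀, ‖∑ d ∈ k.divisors, b d * a (k / d)‖ ^ 2 * ∫ σ, (k : ℝ) ^ (-2 * σ) ∂μ := by
    refine Finset.sum_subset (Finset.filter_subset _ _) fun k hk hk' => ?_
    have : k = 0 := by
      by_contra h
      exact hk' (Finset.mem_filter.2 ⟨hk, by omega⟩)
    subst this
    simp
  rw [← hFF]
  have hrp : ∀ n : ℕ, 1 ≤ n → ∀ σ : ℝ, (n : ℝ) ^ (-2 * σ) = Real.exp (-2 * σ * Real.log n) := by
    intro n hn σ
    rw [Real.rpow_def_of_pos (by exact_mod_cast hn), mul_comm]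
  have key : ∀ σ : ℝ, 0 ≤ σ →
      ∑ k ∈ F, ‖∑ d ∈ k.divisors, b d * a (k / d)‖ ^ 2 * (k : ℝ) ^ (-2 * σ) ≤
      M ^ 2 * ∑ n ∈ Finset.Icc n₀ N, ‖a n‖ ^ 2 * (n : ℝ) ^ (-2 * σ) := by
    have key2 : ∀ σ ∈ closure (Set.Ioi (0:ℝ)),
        ∑ k ∈ F, ‖∑ d ∈ k.divisors, b d * a (k / d)‖ ^ 2 * Real.exp (-2 * σ * Real.log k) ≤
        M ^ 2 * ∑ n ∈ Finset.Icc n₀ N, ‖a n‖ ^ 2 * Real.exp (-2 * σ * Real.log n) := by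
      intro σ hσ
      refine le_on_closure (s := Set.Ioi (0:ℝ))
        (f := fun σ => ∑ k ∈ F, ‖∑ d ∈ k.divisors, b d * a (k / d)‖ ^ 2 *
          Real.exp (-2 * σ * Real.log k))
        (g := fun σ => M ^ 2 * ∑ n ∈ Finset.Icc n₀ N, ‖a n‖ ^ 2 * Real.exp (-2 * σ * Real.log n))
        (fun σ hσ => key_pos b φ M hM hconv hbdd _ hS a ha F hF σ hσ) ?_ ?_ hσ
      · exact Continuous.continuousOn (by fun_prop)
      · exact Continuous.continuousOn (by fun_prop)
    intro σ hσ
    have := key2 σ (by rw [closure_Ioi]; exact hσ)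
    rw [Finset.sum_congr rfl fun k hk => by rw [hrp k (hF k hk)],
      Finset.sum_congr (s₁ := Finset.Icc n₀ N) rfl fun k hk => by rw [hrp k (hS k hk)]]
    exact this
  have i1 : ∀ k ∈ F, Integrable (fun σ : ℝ =>
      ‖∑ d ∈ k.divisors, b d * a (k / d)‖ ^ 2 * (k : ℝ) ^ (-2 * σ)) μ :=
    fun k hk => (hint k (hF k hk)).const_mul _
  have i2 : ∀ n ∈ Finset.Icc n₀ N, Integrable (fun σ : ℝ => ‖a n‖ ^ 2 * (n : ℝ) ^ (-2 * σ)) μ :=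
    fun k hk => (hint k (hS k hk)).const_mul _
  simp only [← integral_const_mul]
  rw [← integral_finsetSum _ i1, ← integral_finsetSum _ i2, ← integral_const_mul]
  refine integral_mono_ae (integrable_finsetSum _ i1) ((integrable_finsetSum _ i2).const_mul _) ?_
  have hae : ∀ᵐ σ ∂μ, 0 ≤ σ := by
    rw [ae_iff]
    simpa [Set.Iio] using hneg
  filter_upwards [hae] with σ hσ
  exact key σ hσ
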